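/- Let U be the subalgebra of the q-shuffle algebra V generated by x and y under the q-shuffle product, and let J be the two-sided ideal of the free (concatenation) algebra V generated by xxxy − [3]_q xxyx + [3]_q xyxx − yxxx and yyyx − [3]_q yyxy + [3]_q yxyy − xyyy, where [3]_q = q^2 + 1 + q^{-2}. A word w lies in U if and only if w contains none of the following as a (contiguous) subword: xxxy, xxyx, xyxx, yxxx, yyyx, yyxy, yxyy, xyyy. (You may use as a hypothesis that U equals the orthogonal complement of J with respect to the bilinear form on V for which the words form an orthonormal basis.) -/

import Mathlib

noncomputable section

/-- The letter `x`. -/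
def bX : Bool := false
/-- The letter `y`. -/
def bY : Bool := true

/-- The bilinear pairing on letters: `⟨x,x⟩ = ⟨y,y⟩ = 2`, `⟨x,y⟩ = ⟨y,x⟩ = -2`. -/
def qbr (a b : Bool) : ℤ := if a = b then 2 else -2

/-- The sum `⟨a, w₁⟩ + ⋯ + ⟨a, wₙ⟩` for a letter `a` and a word `w`. -/
def qE (a : Bool) (w : List Bool) : ℤ := (w.map (qbr a)).sum

/-- Linear map on the free algebra (words-indexed finsupps) given by prepending a letter. -/
def qcons (F : Type*) [Field F] (a : Bool) :
    (List Bool →₀ F) →ₗ[F] (List Bool →₀ F) :=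
  Finsupp.lmapDomain F F (List.cons a)

/-- The q-shuffle product of two words, as an element of the free algebra `List Bool →₀ F`.
Defined by the recursion `u ⋆ v = u₁((u₂⋯u_r) ⋆ v) + q^{⟨v₁,u₁⟩+⋯+⟨v₁,u_r⟩} v₁(u ⋆ (v₂⋯v_s))`. -/
def qsh {F : Type*} [Field F] (q : F) : List Bool → List Bool → (List Bool →₀ F)
  | [], v => Finsupp.single v 1
  | a :: u, [] => Finsupp.single (a :: u) 1
  | a :: u, b :: v =>
      qcons F a (qsh q u (b :: v)) +
        (q ^ (qbr b a + qE b u)) • qcons F b (qsh q (a :: u) v)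
  termination_by u v => u.length + v.length
  decreasing_by all_goals (simp only [List.length_cons]; omega)

/-- Concatenation power of a word. -/
def wpow (w : List Bool) : ℕ → List Bool
  | 0 => []
  | n + 1 => w ++ wpow w n

def wXXYY : List Bool := [bX, bX, bY, bY]
def wYYXX : List Bool := [bY, bY, bX, bX]
def wXY : List Bool := [bX, bY]
def wYX : List Bool := [bY, bX]

/-- The bilinear extension of the q-shuffle product to the whole free algebra. -/
def qstar {F : Type*} [Field F] (q : F) (u v : List Bool →₀ F) : List Bool →₀ F :=
  u.sum fun w1 c1 => v.sum fun w2 c2 => (c1 * c2) • qsh q w1 w2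

/-- Membership in `U`, the subalgebra of the q-shuffle algebra generated by `x` and `y`. -/
inductive memU {F : Type*} [Field F] (q : F) : (List Bool →₀ F) → Prop
  | one : memU q (Finsupp.single [] 1)
  | genX : memU q (Finsupp.single [bX] 1)
  | genY : memU q (Finsupp.single [bY] 1)
  | add {u v} : memU q u → memU q v → memU q (u + v)
  | smul (c : F) {u} : memU q u → memU q (c • u)
  | mul {u v} : memU q u → memU q v → memU q (qstar q u v)


set_option linter.all false
section Helpers
variable {F : Type*} [Field F]

theorem H_ext {W : Type*} [AddCommMonoid W] [Module F W] (f g : (List Bool →₀ F) →ₗ[F] W)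
    (h : ∀ w, f (Finsupp.single w 1) = g (Finsupp.single w 1)) : f = g := by
  apply Finsupp.lhom_ext'
  intro w
  ext
  simpa using h w

def HS (q : F) : (List Bool →₀ F) →ₗ[F] (List Bool →₀ F) →ₗ[F] (List Bool →₀ F) :=
  Finsupp.linearCombination F (fun w1 => Finsupp.linearCombination F (fun w2 => qsh q w1 w2))

theorem HS_eq (q : F) (u v : List Bool →₀ F) : HS q u v = qstar q u v := by
  simp [HS, qstar, Finsupp.linearCombination_apply, Finsupp.sum, LinearMap.sum_apply,
    Finset.smul_sum, smul_smul]

theorem HS_single (q : F) (w1 w2 : List Bool) :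
    HS q (Finsupp.single w1 1) (Finsupp.single w2 1) = qsh q w1 w2 := by
  simp [HS]

def HD (F : Type*) [Field F] (a : Bool) : (List Bool →₀ F) →ₗ[F] (List Bool →₀ F) :=
  Finsupp.linearCombination F (fun w => match w with
    | [] => 0
    | b :: w => if b = a then Finsupp.single w 1 else 0)

def HK (q : F) (a : Bool) : (List Bool →₀ F) →ₗ[F] (List Bool →₀ F) :=
  Finsupp.linearCombination F (fun w => q ^ (qE a w) • Finsupp.single w (1 : F))

theorem HD_nil (a : Bool) (c : F) : HD F a (Finsupp.single [] c) = 0 := by simp [HD]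

theorem HD_cons (a b : Bool) (w : List Bool) (c : F) : HD F a (Finsupp.single (b :: w) c) =
    if b = a then Finsupp.single w c else 0 := by
  simp only [HD, Finsupp.linearCombination_single]
  split_ifs <;> simp

theorem HK_single (q : F) (a : Bool) (w : List Bool) (c : F) :
    HK q a (Finsupp.single w c) = q ^ (qE a w) • Finsupp.single w c := by
  simp [HK, mul_comm]

theorem qcons_single (a : Bool) (w : List Bool) (c : F) :
    qcons F a (Finsupp.single w c) = Finsupp.single (a :: w) c := by
  simp [qcons, Finsupp.mapDomain_single]

theorem HD_qcons (a b : Bool) (v : List Bool →₀ F) :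
    HD F a (qcons F b v) = if b = a then v else 0 := by
  have := H_ext ((HD F a).comp (qcons F b)) (if b = a then LinearMap.id else 0) (by
    intro w
    simp only [LinearMap.comp_apply, qcons_single, HD_cons]
    split_ifs <;> simp)
  have := congrArg (fun f => f v) this
  simp only [LinearMap.comp_apply] at this
  rw [this]; split_ifs <;> simp

theorem qE_nil (a : Bool) : qE a [] = 0 := by simp [qE]
theorem qE_cons (a b : Bool) (w : List Bool) : qE a (b :: w) = qbr a b + qE a w := by simp [qE]
theorem qbr_comm (a b : Bool) : qbr a b = qbr b a := by cases a <;> cases b <;> rfl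

theorem HK_qcons (q : F) (hq : q ≠ 0) (a b : Bool) (v : List Bool →₀ F) :
    HK q b (qcons F a v) = q ^ (qbr b a) • qcons F a (HK q b v) := by
  have := H_ext ((HK q b).comp (qcons F a)) (q ^ (qbr b a) • (qcons F a).comp (HK q b)) (by
    intro w
    simp only [LinearMap.comp_apply, LinearMap.smul_apply, qcons_single, HK_single, map_smul, qE_cons,
      zpow_add₀ hq, smul_smul])
  have := congrArg (fun f => f v) this
  simpa using this

theorem HD_HK (q : F) (hq : q ≠ 0) (a b : Bool) (v : List Bool →₀ F) :
    HD F a (HK q b v) = q ^ (qbr b a) • HK q b (HD F a v) := by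
  have := H_ext ((HD F a).comp (HK q b)) (q ^ (qbr b a) • (HK q b).comp (HD F a)) (by
    intro w
    cases w with
    | nil => simp [HD_nil, HK_single]
    | cons c w =>
      simp only [LinearMap.comp_apply, LinearMap.smul_apply, HK_single, map_smul, HD_cons]
      split_ifs with h
      · simp only [HK_single, h, qE_cons, zpow_add₀ hq, smul_smul]
      · simp)
  have := congrArg (fun f => f v) this
  simpa using this

theorem HK_HK (q : F) (a b : Bool) (v : List Bool →₀ F) :
    HK q a (HK q b v) = HK q b (HK q a v) := by
  have := H_ext ((HK q a).comp (HK q b)) ((HK q b).comp (HK q a)) (by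
    intro w
    simp only [LinearMap.comp_apply, HK_single, map_smul, smul_smul, mul_comm])
  have := congrArg (fun f => f v) this
  simpa using this

theorem qsh_nil_left (q : F) (v : List Bool) : qsh q [] v = Finsupp.single v 1 := by
  simp [qsh]
theorem qsh_nil_right (q : F) (v : List Bool) : qsh q v [] = Finsupp.single v 1 := by
  cases v <;> simp [qsh]
theorem qsh_cons (q : F) (a b : Bool) (u v : List Bool) : qsh q (a :: u) (b :: v) =
      qcons F a (qsh q u (b :: v)) +
        (q ^ (qE b (a :: u))) • qcons F b (qsh q (a :: u) v) := by
  rw [qsh, qE_cons]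

theorem HK_qsh (q : F) (hq : q ≠ 0) (a : Bool) : ∀ (u v : List Bool),
    HK q a (qsh q u v) = q ^ (qE a u + qE a v) • qsh q u v
  | [], v => by simp [qsh_nil_left, HK_single, qE_nil]
  | b :: u, [] => by simp [qsh_nil_right, HK_single, qE_nil]
  | b :: u, c :: v => by
    rw [qsh_cons, map_add, map_smul, HK_qcons q hq, HK_qcons q hq, HK_qsh q hq a u (c :: v),
      HK_qsh q hq a (b :: u) v]
    simp only [map_smul, smul_add, smul_smul, qE_cons, ← zpow_add₀ hq]
    congr 2 <;> ring_nf
  termination_by u v => u.length + v.length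

theorem HK_HS (q : F) (hq : q ≠ 0) (a : Bool) (u v : List Bool →₀ F) :
    HK q a (HS q u v) = HS q (HK q a u) (HK q a v) := by
  have := H_ext ((HS q).compr₂ (HK q a)) ((HS q).compl₁₂ (HK q a) (HK q a)) (by
    intro w1
    apply H_ext
    intro w2
    simp only [LinearMap.compr₂_apply, LinearMap.compl₁₂_apply, HS_single, HK_qsh q hq, HK_single,
      map_smul, LinearMap.smul_apply, smul_smul, zpow_add₀ hq]
    rw [mul_comm])
  have := congrArg (fun f => f u v) this
  simpa using this

theorem HD_HS (q : F) (a : Bool) (u v : List Bool →₀ F) :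
    HD F a (HS q u v) = HS q (HD F a u) v + HS q (HK q a u) (HD F a v) := by
  have := H_ext ((HS q).compr₂ (HD F a))
    ((HS q).compl₁₂ (HD F a) LinearMap.id + (HS q).compl₁₂ (HK q a) (HD F a)) (by
    intro w1
    apply H_ext
    intro w2
    simp only [LinearMap.compr₂_apply, LinearMap.compl₁₂_apply, HS_single, HK_single,
      map_smul, LinearMap.smul_apply, LinearMap.add_apply, LinearMap.id_apply]
    cases w1 with
    | nil => 
      cases w2 with
      | nil => simp [qsh_nil_left, HD_nil]
      | cons c w2 =>
        simp only [qsh_nil_left, HD_nil, HD_cons, qE_nil]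
        split_ifs <;> simp [HS_single, qsh_nil_left]
    | cons b w1 => 
      cases w2 with
      | nil => 
        simp only [qsh_nil_right, HD_nil, HD_cons]
        split_ifs <;> simp [HS_single, qsh_nil_right]
      | cons c w2 => 
        simp only [qsh_cons, HD_cons, map_add, map_smul, HD_qcons]
        split_ifs <;> simp_all [HS_single])
  have := congrArg (fun f => f u v) this
  simpa using this

def HR (q : F) (a b : Bool) (v : List Bool →₀ F) : List Bool →₀ F :=
  HD F b (HD F a (HD F a (HD F a v))) - (q^2 + 1 + (q^2)⁻¹) • HD F a (HD F b (HD F a (HD F a v)))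
   + (q^2 + 1 + (q^2)⁻¹) • HD F a (HD F a (HD F b (HD F a v))) - HD F a (HD F a (HD F a (HD F b v)))

theorem HR_HS (q : F) (hq : q ≠ 0) (a b : Bool) (hab : qbr a b = -2) (u v : List Bool →₀ F)
    (hu : HR q a b u = 0) (hv : HR q a b v = 0) : HR q a b (HS q u v) = 0 := by
  have hba : qbr b a = -2 := by rw [qbr_comm]; exact hab
  have haa : qbr a a = 2 := by simp [qbr]
  have hbb : qbr b b = 2 := by simp [qbr]
  unfold HR at *
  have hu' := eq_of_sub_eq_zero hu
  have hv' := eq_of_sub_eq_zero hv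
  have e1 : q ^ (2:ℤ) = q ^ 2 := by norm_cast
  have e2 : q ^ (-2:ℤ) = (q ^ 2)⁻¹ := by rw [zpow_neg, e1]
  have hp : q ^ 2 ≠ 0 := pow_ne_zero 2 hq
  generalize q ^ 2 = p at *
  simp only [HD_HS, map_add, map_smul, HD_HK q hq, hab, hba, haa, hbb, e1, e2, LinearMap.add_apply,
    LinearMap.smul_apply, HK_HK q b a, ← hu', ← hv', map_sub, LinearMap.sub_apply]
  match_scalars <;> field_simp <;> ring

theorem memU_zero (q : F) : memU q 0 := by
  simpa using memU.smul (0 : F) (memU.one (q := q))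

theorem memU_HK (q : F) (hq : q ≠ 0) (a : Bool) (v : List Bool →₀ F) (h : memU q v) :
    memU q (HK q a v) := by
  induction h with
  | one => rw [HK_single]; exact .smul _ .one
  | genX => rw [HK_single]; exact .smul _ .genX
  | genY => rw [HK_single]; exact .smul _ .genY
  | add _ _ h1 h2 => rw [map_add]; exact .add h1 h2
  | smul c _ h => rw [map_smul]; exact .smul _ h
  | mul _ _ h1 h2 => rw [← HS_eq, HK_HS q hq, HS_eq]; exact .mul h1 h2

theorem memU_HD (q : F) (hq : q ≠ 0) (a : Bool) (v : List Bool →₀ F) (h : memU q v) :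
    memU q (HD F a v) := by
  induction h with
  | one => rw [HD_nil]; exact memU_zero q
  | genX => rw [HD_cons]; split_ifs; exacts [.one, memU_zero q]
  | genY => rw [HD_cons]; split_ifs; exacts [.one, memU_zero q]
  | add _ _ h1 h2 => rw [map_add]; exact .add h1 h2
  | smul c _ h => rw [map_smul]; exact .smul _ h
  | mul m1 m2 h1 h2 =>
    rw [← HS_eq, HD_HS, HS_eq, HS_eq]; exact .add (.mul h1 m2) (.mul (memU_HK q hq a _ m1) h2)

theorem memU_HR (q : F) (hq : q ≠ 0) (a b : Bool) (hab : qbr a b = -2) (v : List Bool →₀ F)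
    (h : memU q v) : HR q a b v = 0 := by
  induction h with
  | one => simp [HR, HD_nil]
  | genX => cases a <;> cases b <;> simp [HR, HD_nil, HD_cons, bX]
  | genY => cases a <;> cases b <;> simp [HR, HD_nil, HD_cons, bY]
  | @add u v _ _ h1 h2 =>
    have : HR q a b (u + v) = HR q a b u + HR q a b v := by
      simp only [HR, map_add]; module
    rw [this, h1, h2, add_zero]
  | @smul c u _ h =>
    have : HR q a b (c • u) = c • HR q a b u := by
      simp only [HR, map_smul]; module
    rw [this, h, smul_zero]
  | mul m1 m2 h1 h2 =>
    rw [← HS_eq]; exact HR_HS q hq a b hab _ _ h1 h2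

theorem memU_suffix (q : F) (hq : q ≠ 0) (l r : List Bool)
    (h : memU q (Finsupp.single (l ++ r) 1)) : memU q (Finsupp.single r (1 : F)) := by
  induction l with
  | nil => exact h
  | cons a l ih =>
    apply ih
    have := memU_HD q hq a _ h
    simpa [HD_cons] using this

theorem three_ne (q : F) (hq : q ≠ 0) (hq1 : ∀ m : ℕ, 0 < m → q ^ m ≠ 1) :
    q^2 + 1 + (q^2)⁻¹ ≠ 0 := by
  intro h
  apply hq1 6 (by norm_num)
  field_simp at h
  linear_combination (q^2 - 1) * h

theorem forward (q : F) (hq : q ≠ 0) (hq1 : ∀ m : ℕ, 0 < m → q ^ m ≠ 1) (w : List Bool)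
    (h : memU q (Finsupp.single w (1 : F))) :
      ∀ s ∈ [[bX, bX, bX, bY], [bX, bX, bY, bX], [bX, bY, bX, bX], [bY, bX, bX, bX],
              [bY, bY, bY, bX], [bY, bY, bX, bY], [bY, bX, bY, bY], [bX, bY, bY, bY]],
        ¬ s <:+: w := by
  rintro s hs ⟨l, r, rfl⟩
  rw [List.append_assoc] at h
  have h1 := memU_suffix q hq _ _ h
  have h2 := memU_HR q hq false true rfl _ h1
  have h3 := memU_HR q hq true false rfl _ h1
  have h4 := three_ne q hq hq1
  unfold HR at h2 h3
  generalize q^2 + 1 + (q^2)⁻¹ = t at *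
  simp only [List.mem_cons, List.not_mem_nil, or_false, bX, bY] at hs
  rcases hs with rfl | rfl | rfl | rfl | rfl | rfl | rfl | rfl <;>
    simp [HD_cons, h4] at h2 h3

def HU (q : F) : Submodule F (List Bool →₀ F) where
  carrier := {v | memU q v}
  add_mem' := fun h1 h2 => memU.add h1 h2
  zero_mem' := memU_zero q
  smul_mem' := fun c _ h => memU.smul c h

theorem HU_qsh (q : F) (u v : List Bool) (hu : Finsupp.single u 1 ∈ HU q)
    (hv : Finsupp.single v 1 ∈ HU q) : qsh q u v ∈ HU q := by
  have : memU q _ := memU.mul hu hv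
  rw [← HS_eq, HS_single] at this
  exact this

theorem HU_gen (q : F) (a : Bool) : Finsupp.single [a] 1 ∈ HU q := by
  cases a
  · exact memU.genX
  · exact memU.genY

def hsg (b : Bool) : ℤ := if b then -1 else 1
def hd (w : List Bool) : ℤ := (w.map hsg).sum
def he (w : List Bool) : ℤ := hd w ^ 2 - w.length

theorem hd_cons (b : Bool) (w : List Bool) : hd (b :: w) = hsg b + hd w := by simp [hd]
theorem qE_eq (a : Bool) (w : List Bool) : qE a w = 2 * hsg a * hd w := by
  induction w with
  | nil => simp [qE, hd]
  | cons b w ih =>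
    rw [qE_cons, hd_cons, ih]
    cases a <;> cases b <;> simp [qbr, hsg] <;> ring
theorem he_cons (c : Bool) (w : List Bool) : he (c :: w) = he w + qE c w := by
  rw [qE_eq, he, he, hd_cons]
  cases c <;> simp [hsg] <;> ring

theorem anti (q : F) (hq : q ≠ 0) (v : List Bool) : ∀ (r : List Bool) (b : Bool)
    (_ : ∀ r' v', r'.reverse ++ v' = (b :: r).reverse ++ v → r' ≠ [] → v' ≠ [] → qsh q r' v' ∈ HU q),
    qcons F b (qsh q r v) - ((-1) ^ v.length * q ^ (he (v.reverse ++ b :: r) - he (b :: r))) •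
      Finsupp.single (v.reverse ++ b :: r) (1 : F) ∈ HU q := by
  induction v with
  | nil =>
    intro r b h
    simp [qsh_nil_right, qcons_single]
  | cons c v ih =>
    intro r b h
    have h1 := ih (b :: r) c (by
      intro r' v' e
      apply h
      rw [e]; simp)
    have h2 := h (b :: r) (c :: v) rfl (by simp) (by simp)
    have h3 := (HU q).sub_mem h2 ((HU q).smul_mem (q ^ (qE c (b :: r))) h1)
    rw [qsh_cons] at h3
    convert h3 using 1
    have e1 : (c :: v).reverse ++ b :: r = v.reverse ++ c :: b :: r := by simp
    rw [e1, he_cons c (b :: r)]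
    generalize he (v.reverse ++ c :: b :: r) = E
    have : q ^ (E - he (b :: r)) = q ^ (qE c (b :: r)) * q ^ (E - (he (b :: r) + qE c (b :: r))) := by
      rw [← zpow_add₀ hq]; ring_nf
    rw [this, List.length_cons, pow_succ]
    module

def Av (w : List Bool) : Prop :=
  ∀ s ∈ [[bX, bX, bX, bY], [bX, bX, bY, bX], [bX, bY, bX, bX], [bY, bX, bX, bX],
              [bY, bY, bY, bX], [bY, bY, bX, bY], [bY, bX, bY, bY], [bX, bY, bY, bY]],
        ¬ s <:+: w

theorem Av_infix {u w : List Bool} (h : u <:+: w) (hw : Av w) : Av u :=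
  fun s hs hi => hw s hs (hi.trans h)

theorem Av_reverse {w : List Bool} (hw : Av w) : Av w.reverse := by
  intro s hs hi
  apply hw s.reverse _ (by rw [← List.reverse_reverse w]; exact List.reverse_infix.2 hi)
  revert hs
  simp only [List.mem_cons, List.not_mem_nil, or_false]
  rintro (rfl | rfl | rfl | rfl | rfl | rfl | rfl | rfl) <;> simp

theorem anti' (q : F) (hq : q ≠ 0) (w : List Bool) (hw : w ≠ []) (ha : Av w)
    (IH : ∀ u : List Bool, u.length < w.length → Av u → Finsupp.single u 1 ∈ HU q) :
    Finsupp.single w (1 : F) + ((-1) ^ w.length * q ^ (he w.reverse)) •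
      Finsupp.single w.reverse (1 : F) ∈ HU q := by
  cases w with
  | nil => exact absurd rfl hw
  | cons b v =>
    have := anti q hq v [] b (by
      intro r' v' e h1 h2
      have e' : r'.reverse ++ v' = b :: v := by simpa using e
      have hl := congrArg List.length e'
      rw [List.length_append, List.length_reverse] at hl
      have l1 := List.length_pos_of_ne_nil h1
      have l2 := List.length_pos_of_ne_nil h2
      apply HU_qsh
      · apply IH _ (by omega)
        rw [← List.reverse_reverse r']
        exact Av_reverse (Av_infix (e' ▸ (List.prefix_append _ _).isInfix) ha)
      · apply IH _ (by omega)
        exact Av_infix (e' ▸ (List.suffix_append _ _).isInfix) ha)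
    convert this using 1
    have e0 : he [b] = 0 := by cases b <;> simp [he, hd, hsg]
    rw [qsh_nil_left, qcons_single, e0, sub_zero, List.reverse_cons, List.length_cons, pow_succ]
    module

def hs (q : F) (k : ℤ) : F := q ^ k - q ^ (-k)

def HE (q : F) (a : Bool) : ℤ → List Bool → (List Bool →₀ F)
  | k, [] => hs q k • Finsupp.single [a] 1
  | k, b :: w => hs q k • Finsupp.single (a :: b :: w) 1 + qcons F b (HE q a (k + qbr a b) w)

theorem HE_eq (q : F) (hq : q ≠ 0) (a : Bool) (w : List Bool) : ∀ k : ℤ,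
    HE q a k w = q ^ k • qsh q [a] w - q ^ (-k - qE a w) • qsh q w [a] := by
  induction w with
  | nil => intro k; simp [HE, qsh_nil_left, qsh_nil_right, hs, qE_nil, sub_smul]
  | cons b w ih =>
    intro k
    rw [HE, ih, qsh_cons, qsh_cons, qsh_nil_left, qsh_nil_right, qcons_single, map_sub,
      map_smul, map_smul, hs]
    have e1 : q ^ (-k) = q ^ (-k - qE a (b :: w)) * q ^ (qE a (b :: w)) := by
      rw [← zpow_add₀ hq]; ring_nf
    have e2 : q ^ (k + qbr a b) = q ^ k * q ^ (qE b [a]) := by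
      rw [← zpow_add₀ hq]; simp [qE, qbr_comm]
    have e3 : -(k + qbr a b) - qE a w = -k - qE a (b :: w) := by rw [qE_cons]; ring
    rw [e1, e2, e3]
    module

theorem HE_mem (q : F) (hq : q ≠ 0) (a : Bool) (w : List Bool) (k : ℤ)
    (h : Finsupp.single w 1 ∈ HU q) : HE q a k w ∈ HU q := by
  rw [HE_eq q hq]
  exact (HU q).sub_mem ((HU q).smul_mem _ (HU_qsh q _ _ (HU_gen q a) h))
    ((HU q).smul_mem _ (HU_qsh q _ _ h (HU_gen q a)))

def al : Bool → ℕ → List Bool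
  | _, 0 => []
  | a, n + 1 => a :: al (!a) n

def dw : Bool → Bool → ℕ → List Bool
  | _, _, 0 => []
  | a, b, n + 1 => a :: dw b (!a) n

def dc : Bool → Bool → ℕ → Bool
  | a, _, 0 => a
  | a, b, n + 1 => dc b (!a) n

theorem qbr_same (a : Bool) : qbr a a = 2 := by simp [qbr]
theorem qbr_not (a : Bool) : qbr a (!a) = -2 := by cases a <;> simp [qbr]
theorem hs_zero (q : F) : hs q 0 = 0 := by simp [hs]
theorem hs_neg (q : F) (k : ℤ) : hs q (-k) = - hs q k := by simp [hs]

theorem HE_al (q : F) (a : Bool) : ∀ n : ℕ, HE q a (-1) (al a n) =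
    if n % 2 = 0 then -(hs q 1 • Finsupp.single (al a (n + 1)) 1) else 0
  | 0 => by simp [al, HE, hs_neg]
  | 1 => by simp [al, HE, hs_neg, qbr_same, qcons_single]
  | n + 2 => by
    have ih := HE_al q a n
    simp only [al, Bool.not_not, HE, qbr_same, qbr_not]
    norm_num only
    rw [ih, Nat.add_mod_right]
    simp only [map_add, map_smul, qcons_single, hs_neg]
    split_ifs
    · simp only [map_neg, map_smul, qcons_single, al, Bool.not_not]; module
    · simp

theorem HE_dw (q : F) (a : Bool) : ∀ n : ℕ, HE q a (-2) (dw a a n) =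
    if n % 4 < 2 then -(hs q 2 • Finsupp.single (dw a a (n + 1)) 1) else 0
  | 0 => by simp [dw, HE, hs_neg]
  | 1 => by simp [dw, HE, hs_neg, hs_zero, qbr_same]
  | 2 => by simp [dw, HE, hs_neg, hs_zero, qbr_same, qcons_single]
  | 3 => by simp [dw, HE, hs_neg, hs_zero, qbr_same, qbr_not, qcons_single]
  | n + 4 => by
    have ih := HE_dw q a n
    simp only [dw, Bool.not_not, HE, qbr_same, qbr_not]
    norm_num only
    rw [ih, Nat.add_mod_right]
    simp only [map_add, map_smul, qcons_single, hs_neg, hs_zero, zero_smul, map_zero]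
    split_ifs
    · simp only [map_neg, map_smul, qcons_single, dw, Bool.not_not]; module
    · simp

theorem al_succ (n : ℕ) : ∀ a, al a (n + 1) = al a n ++ [if n % 2 = 0 then a else !a] := by
  induction n with
  | zero => intro a; simp [al]
  | succ n ih =>
    intro a
    rw [al, ih (!a), al, List.cons_append]
    rcases Nat.mod_two_eq_zero_or_one n with h | h <;> simp [h, Nat.add_mod]

theorem al_reverse (n : ℕ) (a : Bool) : (al a n).reverse = al (if n % 2 = 0 then !a else a) n := by
  induction n with
  | zero => simp [al]
  | succ n ih =>
    rw [al_succ, List.reverse_append, ih]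
    rcases Nat.mod_two_eq_zero_or_one n with h | h <;> simp [h, Nat.add_mod, al]

theorem dw_succ (n : ℕ) : ∀ a b, dw a b (n + 1) = dw a b n ++ [dc a b n] := by
  induction n with
  | zero => intro a b; simp [dw, dc]
  | succ n ih =>
    intro a b
    rw [dw, ih b (!a), dw, List.cons_append, dc]

theorem dc_two (n : ℕ) : ∀ a b, dc a b (n + 2) = !(dc a b n) := by
  induction n with
  | zero => intro a b; simp [dc]
  | succ n ih => intro a b; rw [dc, ih, dc]

theorem dw_reverse (n : ℕ) (a b : Bool) :
    (dw a b n).reverse = dw (dc a b (n + 3)) (dc a b (n + 2)) n := by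
  induction n with
  | zero => simp [dw]
  | succ n ih =>
    rw [dw_succ, List.reverse_append, ih]
    simp [dw, dc_two]

theorem dc_mul (k j : ℕ) (a b : Bool) : dc a b (4 * k + j) = dc a b j := by
  induction k with
  | zero => simp
  | succ k ih =>
    rw [← ih, show 4 * (k + 1) + j = (4 * k + j) + 2 + 2 by ring, dc_two, dc_two, Bool.not_not]

theorem length_al (n : ℕ) : ∀ a, (al a n).length = n := by
  induction n with
  | zero => intro a; rfl
  | succ n ih => intro a; simp [al, ih]

theorem length_dw (n : ℕ) : ∀ a b, (dw a b n).length = n := by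
  induction n with
  | zero => intro a b; rfl
  | succ n ih => intro a b; simp [dw, ih]

theorem hd_dw (k j : ℕ) (a b : Bool) : hd (dw a b (4 * k + j)) = hd (dw a b j) := by
  induction k with
  | zero => simp
  | succ k ih =>
    rw [← ih, show 4 * (k + 1) + j = (4 * k + j) + 4 by ring]
    cases a <;> cases b <;> simp [dw, hd_cons, hsg]

theorem Av_al (n : ℕ) : ∀ a, Av (al a n) := by
  induction n with
  | zero => intro a s hs hi; rw [al, List.infix_nil] at hi; subst hi; simp at hs
  | succ n ih =>
    intro a s hs hi
    rw [al, List.infix_cons_iff] at hi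
    rcases hi with hi | hi
    · revert hi
      simp only [List.mem_cons, List.not_mem_nil, or_false, bX, bY] at hs
      rcases n with _ | _ | _ | n <;>
      rcases hs with rfl | rfl | rfl | rfl | rfl | rfl | rfl | rfl <;> cases a <;>
        simp [al, List.cons_prefix_cons]
    · exact ih _ s hs hi

theorem Av_dw (n : ℕ) : ∀ a b, Av (dw a b n) := by
  induction n with
  | zero => intro a b s hs hi; rw [dw, List.infix_nil] at hi; subst hi; simp at hs
  | succ n ih =>
    intro a b s hs hi
    rw [dw, List.infix_cons_iff] at hi
    rcases hi with hi | hi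
    · revert hi
      simp only [List.mem_cons, List.not_mem_nil, or_false, bX, bY] at hs
      rcases n with _ | _ | _ | n <;>
      rcases hs with rfl | rfl | rfl | rfl | rfl | rfl | rfl | rfl <;> cases a <;> cases b <;>
        simp [dw, List.cons_prefix_cons]
    · exact ih _ _ s hs hi

theorem Av_four {w : List Bool} (a b c d : Bool) (h : Av (a :: b :: c :: d :: w)) :
    (a = b ∧ b = c ∧ c = d) ∨ (c = !a ∧ d = !b) ∨ (b = !a ∧ c = a ∧ d = !a) := by
  have h' : [a, b, c, d] ∉ [[bX, bX, bX, bY], [bX, bX, bY, bX], [bX, bY, bX, bX], [bY, bX, bX, bX],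
              [bY, bY, bY, bX], [bY, bY, bX, bY], [bY, bX, bY, bY], [bX, bY, bY, bY]] :=
    fun hs => h _ hs ⟨[], w, rfl⟩
  revert h'
  cases a <;> cases b <;> cases c <;> cases d <;> simp [bX, bY]

theorem classify (w : List Bool) (h : Av w) : (∃ a n, w = List.replicate n a) ∨
    (∃ a n, w = al a n) ∨ ∃ a b n, w = dw a b n := by
  induction w with
  | nil => exact .inl ⟨true, 0, rfl⟩
  | cons a w ih =>
    have ih := ih (Av_infix (List.suffix_cons a w).isInfix h)
    match w, h, ih with
    | [], h, ih => exact .inl ⟨a, 1, rfl⟩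
    | [b], h, ih => exact .inr (.inr ⟨a, b, 2, rfl⟩)
    | [b, c], h, ih =>
      by_cases hc : c = !a
      · exact .inr (.inr ⟨a, b, 3, by simp [dw, hc]⟩)
      · have hc : c = a := by cases a <;> cases c <;> simp_all
        subst hc
        by_cases hb : b = c
        · exact .inl ⟨c, 3, by simp [List.replicate, hb]⟩
        · have hb : b = !c := by cases b <;> cases c <;> simp_all
          exact .inr (.inl ⟨c, 3, by simp [al, hb]⟩)
    | b :: c :: d :: w, h, ih =>
      have h4 := Av_four a b c d h
      rcases ih with ⟨e, n, hn⟩ | ⟨e, n, hn⟩ | ⟨e, f, n, hn⟩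
      · rcases n with _ | _ | _ | n
        · simp at hn
        · simp at hn
        · simp at hn
        simp only [List.replicate_succ, List.cons.injEq] at hn
        obtain ⟨rfl, rfl, rfl, rfl⟩ := hn
        left
        refine ⟨a, n + 4, ?_⟩
        have : a = d := by
          clear * - h4
          revert h4; cases a <;> cases d <;> simp
        simp [List.replicate_succ, this]
      · rcases n with _ | _ | _ | n
        · simp [al] at hn
        · simp [al] at hn
        · simp [al] at hn
        simp only [al, List.cons.injEq] at hn
        obtain ⟨rfl, rfl, rfl, rfl⟩ := hn
        right; left
        refine ⟨a, n + 4, ?_⟩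
        have : b = !a := by cases a <;> cases b <;> simp_all
        simp [al, this]
      · rcases n with _ | _ | _ | n
        · simp [dw] at hn
        · simp [dw] at hn
        · simp [dw] at hn
        simp only [dw, List.cons.injEq] at hn
        obtain ⟨rfl, rfl, rfl, rfl⟩ := hn
        right; right
        refine ⟨a, b, n + 4, ?_⟩
        have : c = !a := by cases a <;> cases b <;> cases c <;> simp_all
        simp [dw, this]

theorem zpow_ne_one' (q : F) (hq : q ≠ 0) (hq1 : ∀ m : ℕ, 0 < m → q ^ m ≠ 1) (e : ℤ) (he : e ≠ 0) :
    q ^ e ≠ 1 := by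
  obtain ⟨m, rfl | rfl⟩ := e.eq_nat_or_neg
  · rw [zpow_natCast]; exact hq1 m (by omega)
  · rw [zpow_neg, zpow_natCast, ne_eq, inv_eq_one]; exact hq1 m (by omega)

theorem hs_ne (q : F) (hq : q ≠ 0) (hq1 : ∀ m : ℕ, 0 < m → q ^ m ≠ 1) (k : ℤ) (hk : k ≠ 0) :
    hs q k ≠ 0 := by
  intro h
  apply zpow_ne_one' q hq hq1 (2 * k) (by omega)
  have : q ^ k = q ^ (-k) := sub_eq_zero.1 h
  rw [two_mul, zpow_add₀ hq]
  nth_rw 1 [this]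
  rw [zpow_neg, inv_mul_cancel₀ (zpow_ne_zero _ hq)]

theorem one_add_ne [CharZero F] (q : F) (hq : q ≠ 0) (hq1 : ∀ m : ℕ, 0 < m → q ^ m ≠ 1) (e : ℤ) :
    1 + q ^ e ≠ 0 := by
  intro h
  by_cases he : e = 0
  · subst he; norm_num at h
  · apply zpow_ne_one' q hq hq1 (2 * e) (by omega)
    rw [two_mul, zpow_add₀ hq]
    linear_combination (q ^ e - 1) * h

theorem pal_even [CharZero F] (q : F) (hq : q ≠ 0) (hq1 : ∀ m : ℕ, 0 < m → q ^ m ≠ 1)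
    (w : List Bool) (hw : w ≠ []) (ha : Av w) (hr : w.reverse = w) (hev : Even w.length)
    (IH : ∀ u : List Bool, u.length < w.length → Av u → Finsupp.single u 1 ∈ HU q) :
    Finsupp.single w (1 : F) ∈ HU q := by
  have := anti' q hq w hw ha IH
  rw [hr, hev.neg_one_pow, one_mul] at this
  rw [← (HU q).smul_mem_iff (one_add_ne q hq hq1 (he w))]
  convert this using 1
  module

/-- From `u - v` and `u + c v` deduce both. -/
theorem two_mem (q c : F) (hc : 1 + c ≠ 0) (u v : List Bool →₀ F) (h1 : u - v ∈ HU q)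
    (h2 : u + c • v ∈ HU q) : u ∈ HU q ∧ v ∈ HU q := by
  have hv : v ∈ HU q := by
    rw [← (HU q).smul_mem_iff hc]
    convert (HU q).sub_mem h2 h1 using 1
    module
  refine ⟨?_, hv⟩
  convert (HU q).add_mem h1 hv using 1
  module

theorem Av_replicate (n : ℕ) (a : Bool) : Av (List.replicate n a) := by
  intro s hs hi
  have h1 : ∀ b ∈ s, b = a := fun b hb => List.eq_of_mem_replicate (hi.subset hb)
  revert h1
  simp only [List.mem_cons, List.not_mem_nil, or_false, bX, bY] at hs
  rcases hs with rfl | rfl | rfl | rfl | rfl | rfl | rfl | rfl <;> cases a <;> simp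

theorem hd_replicate (n : ℕ) (a : Bool) : hd (List.replicate n a) = n * hsg a := by
  simp [hd]

theorem main_rep [CharZero F] (q : F) (hq : q ≠ 0) (hq1 : ∀ m : ℕ, 0 < m → q ^ m ≠ 1) (n : ℕ)
    (IH : ∀ u : List Bool, u.length < n → Av u → Finsupp.single u (1 : F) ∈ HU q) (a : Bool) :
    Finsupp.single (List.replicate n a) (1 : F) ∈ HU q := by
  rcases n with _ | _ | n
  · exact memU.one
  · exact HU_gen q a
  have := anti' q hq (List.replicate (n + 2) a) (by simp) (Av_replicate _ _) (by rw [List.length_replicate]; exact IH)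
  rw [List.reverse_replicate, List.length_replicate] at this
  have e : he (List.replicate (n + 2) a) = (n + 2) * (n + 1) := by
    rw [he, hd_replicate]
    cases a <;> simp [hsg] <;> ring
  rw [e] at this
  have hne : 1 + (-1) ^ (n + 2) * q ^ (((n : ℤ) + 2) * (n + 1)) ≠ 0 := by
    rcases neg_one_pow_eq_or F (n + 2) with h | h
    · rw [h, one_mul]; exact one_add_ne q hq hq1 _
    · rw [h]
      intro h0
      apply zpow_ne_one' q hq hq1 (((n : ℤ) + 2) * (n + 1)) (by positivity)
      linear_combination -h0
  rw [← (HU q).smul_mem_iff hne]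
  convert this using 1
  module

theorem main_al [CharZero F] (q : F) (hq : q ≠ 0) (hq1 : ∀ m : ℕ, 0 < m → q ^ m ≠ 1) (n : ℕ)
    (IH : ∀ u : List Bool, u.length < n → Av u → Finsupp.single u (1 : F) ∈ HU q) (a : Bool) :
    Finsupp.single (al a n) (1 : F) ∈ HU q := by
  rcases n with _ | _ | n
  · exact memU.one
  · exact HU_gen q a
  have h1 := HE_mem q hq a (al (!a) (n + 1)) 1 (IH _ (by simp [length_al]) (Av_al _ _))
  rw [al, HE, qbr_not, Bool.not_not, show (1 : ℤ) + -2 = -1 by norm_num, HE_al] at h1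
  have hs1 := hs_ne q hq hq1 1 (by norm_num)
  split_ifs at h1 with h
  · have h2 := anti' q hq (al a (n + 2)) (by simp [al]) (Av_al _ _) (by rw [length_al]; exact IH)
    have hev : Even (n + 2) := by rw [Nat.even_iff]; omega
    rw [al_reverse, length_al, if_pos (by omega), hev.neg_one_pow, one_mul] at h2
    refine (two_mem q _ (one_add_ne q hq hq1 _) _ _ ?_ h2).1
    rw [← (HU q).smul_mem_iff hs1]
    convert h1 using 1
    simp only [map_neg, map_smul, qcons_single, al, Bool.not_not]
    module
  · rw [← (HU q).smul_mem_iff hs1]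
    convert h1 using 1
    simp [al]

theorem dE (q : F) (hq : q ≠ 0) (hq1 : ∀ m : ℕ, 0 < m → q ^ m ≠ 1) (n : ℕ)
    (IH : ∀ u : List Bool, u.length < n + 3 → Av u → Finsupp.single u (1 : F) ∈ HU q) (a : Bool) :
    (if n % 4 < 2 then
      Finsupp.single (dw a (!a) (n + 3)) (1 : F) - Finsupp.single (dw (!a) (!a) (n + 3)) (1 : F)
     else Finsupp.single (dw a (!a) (n + 3)) (1 : F)) ∈ HU q := by
  have h1 := HE_mem q hq a (dw (!a) (!a) (n + 2)) 2 (IH _ (by simp [length_dw]) (Av_dw _ _ _))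
  simp only [dw, HE, qbr_not, Bool.not_not] at h1
  norm_num only at h1
  rw [HE_dw, hs_zero, zero_smul, zero_add] at h1
  rw [← (HU q).smul_mem_iff (hs_ne q hq hq1 2 (by norm_num))]
  convert h1 using 1
  split_ifs
  · simp only [map_neg, map_smul, qcons_single, dw, Bool.not_not]
    module
  · simp [dw]

theorem main_dw [CharZero F] (q : F) (hq : q ≠ 0) (hq1 : ∀ m : ℕ, 0 < m → q ^ m ≠ 1) (n : ℕ)
    (IH : ∀ u : List Bool, u.length < n → Av u → Finsupp.single u (1 : F) ∈ HU q) (a b : Bool) :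
    Finsupp.single (dw a b n) (1 : F) ∈ HU q := by
  by_cases h3 : n < 3
  · have key : (∃ c, dw a b n = List.replicate n c) ∨ (∃ c, dw a b n = al c n) := by
      interval_cases n
      · exact .inl ⟨a, rfl⟩
      · exact .inl ⟨a, rfl⟩
      · by_cases h : a = b
        · exact .inl ⟨a, by simp [dw, h, List.replicate]⟩
        · exact .inr ⟨a, by cases a <;> cases b <;> simp_all [dw, al]⟩
    rcases key with ⟨c, hc⟩ | ⟨c, hc⟩ <;> rw [hc]
    · exact main_rep q hq hq1 n IH c
    · exact main_al q hq hq1 n IH c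
  have hanti : ∀ a b, _ := fun a b => anti' q hq (dw a b n)
    (by intro h; have := congrArg List.length h; rw [length_dw] at this; simp at this; omega)
    (Av_dw _ _ _) (by rw [length_dw]; exact IH)
  have hpal : ∀ a b, (dw a b n).reverse = dw a b n → Even n →
      Finsupp.single (dw a b n) (1 : F) ∈ HU q := fun a b hr hev => pal_even q hq hq1 (dw a b n)
    (by intro h; have := congrArg List.length h; rw [length_dw] at this; simp at this; omega)
    (Av_dw _ _ _) hr (by rw [length_dw]; exact hev) (by rw [length_dw]; exact IH)
  have hdE : ∀ a, _ := fun a => dE q hq hq1 (n - 3) (by rw [show n - 3 + 3 = n by omega]; exact IH) a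
  rw [show n - 3 + 3 = n by omega] at hdE
  have hb : b = a ∨ b = !a := by cases a <;> cases b <;> simp
  obtain ⟨k, hk⟩ : ∃ k, n = 4 * k ∨ n = 4 * k + 1 ∨ n = 4 * k + 2 ∨ n = 4 * k + 3 :=
    ⟨n / 4, by omega⟩
  rcases hk with hk | hk | hk | hk
  · have h1 : ∀ a, Finsupp.single (dw a (!a) n) (1 : F) ∈ HU q := by
      intro a
      apply hpal
      · rw [dw_reverse, hk, dc_mul, dc_mul]; simp [dc]
      · rw [Nat.even_iff]; omega
    rcases hb with rfl | rfl
    · have := hdE (!b)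
      rw [if_pos (by omega)] at this
      have := (HU q).sub_mem (h1 (!b)) this
      simpa using this
    · exact h1 a
  · have h1 : ∀ a, Finsupp.single (dw a (!a) n) (1 : F) ∈ HU q := by
      intro a
      have := hdE a
      rwa [if_neg (by omega)] at this
    rcases hb with rfl | rfl
    · have := hanti b b
      rw [dw_reverse, show n + 3 = 4 * (k + 1) + 0 by omega, show n + 2 = 4 * k + 3 by omega,
        dc_mul, dc_mul] at this
      simp only [dc] at this
      exact ((HU q).add_mem_iff_left ((HU q).smul_mem _ (h1 b))).1 this
    · exact h1 a
  · rcases hb with rfl | rfl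
    · apply hpal
      · rw [dw_reverse, show n + 3 = 4 * (k + 1) + 1 by omega, show n + 2 = 4 * (k + 1) + 0 by omega,
          dc_mul, dc_mul]; simp [dc]
      · rw [Nat.even_iff]; omega
    · have := hdE a
      rwa [if_neg (by omega)] at this
  · have h1 : ∀ a, Finsupp.single (dw a (!a) n) (1 : F) ∈ HU q ∧
        Finsupp.single (dw (!a) (!a) n) (1 : F) ∈ HU q := by
      intro a
      have h1 := hdE a
      rw [if_pos (by omega)] at h1
      have h2 := hanti a (!a)
      rw [dw_reverse, show n + 3 = 4 * (k + 1) + 2 by omega, show n + 2 = 4 * (k + 1) + 1 by omega,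
        dc_mul, dc_mul] at h2
      simp only [dc] at h2
      refine two_mem q _ ?_ _ _ h1 h2
      have hodd : Odd n := by rw [Nat.odd_iff]; omega
      rw [length_dw, hodd.neg_one_pow]
      intro h0
      have hne : he (dw (!a) (!a) n) ≠ 0 := by
        have : hd (dw (!a) (!a) n) ^ 2 = 1 := by
          rw [hk, hd_dw]; cases a <;> simp [dw, hd, hsg]
        rw [he, this, length_dw]; omega
      apply zpow_ne_one' q hq hq1 _ hne
      linear_combination -h0
    rcases hb with rfl | rfl
    · simpa using (h1 (!b)).2
    · exact (h1 a).1

theorem backward [CharZero F] (q : F) (hq : q ≠ 0) (hq1 : ∀ m : ℕ, 0 < m → q ^ m ≠ 1) (n : ℕ) :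
    ∀ w : List Bool, w.length = n → Av w → Finsupp.single w (1 : F) ∈ HU q := by
  induction n using Nat.strong_induction_on with
  | _ n ih =>
    intro w hw ha
    have IH : ∀ u : List Bool, u.length < n → Av u → Finsupp.single u (1 : F) ∈ HU q :=
      fun u hu h => ih _ hu u rfl h
    rcases classify w ha with ⟨a, m, rfl⟩ | ⟨a, m, rfl⟩ | ⟨a, b, m, rfl⟩
    · rw [List.length_replicate] at hw; subst hw; exact main_rep q hq hq1 m IH a
    · rw [length_al] at hw; subst hw; exact main_al q hq hq1 m IH a
    · rw [length_dw] at hw; subst hw; exact main_dw q hq hq1 m IH a b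

end Helpers

/-- A word lies in `U` iff it contains none of the eight forbidden segments. -/
theorem stmt17 {F : Type*} [Field F] [CharZero F] (q : F) (hq : q ≠ 0)
    (hq1 : ∀ m : ℕ, 0 < m → q ^ m ≠ 1) (w : List Bool) :
    memU q (Finsupp.single w (1 : F)) ↔
      ∀ s ∈ [[bX, bX, bX, bY], [bX, bX, bY, bX], [bX, bY, bX, bX], [bY, bX, bX, bX],
              [bY, bY, bY, bX], [bY, bY, bX, bY], [bY, bX, bY, bY], [bX, bY, bY, bY]],
        ¬ s <:+: w := by
  exact ⟨forward q hq hq1 w, fun h => backward q hq hq1 _ w rfl h⟩
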